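/- arXiv:1901.11024 — 3 statements merged into one kernel-verified Lean document; each statement's English description precedes it below -/
import Mathlib

section
/- Let H be a finite-dimensional Hopf algebra over ℂ whose antipode is involutive (S∘S = id), and let φ ∈ H* be a normalized two-sided integral functional. Then for every x ∈ H, the trace of the ℂ-linear endomorphism of H given by left multiplication by x equals (dim_ℂ H)·φ(x). -/
open TensorProduct

section

open Coalgebra HopfAlgebra LinearMap

variable {K H : Type*} [Field K] [Ring H] [HopfAlgebra K H]

/-- The action `h ↦ h₁ g(h₂)` of a functional `g` on a coalgebra. -/
noncomputable def dualAct (g : Module.Dual K H) : H →ₗ[K] H :=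
  (TensorProduct.rid K H).toLinearMap ∘ₗ lTensor H g ∘ₗ comul

theorem dualAct_apply (g : Module.Dual K H) (h : H) :
    dualAct g h = TensorProduct.rid K H (lTensor H g (comul h)) := rfl

theorem dualAct_eq_sum (g : Module.Dual K H) {ι : Type*} {h : H} (r : Coalgebra.Repr K h ι) :
    dualAct g h = ∑ i ∈ r.index, g (r.right i) • r.left i := by
  simp [dualAct_apply, ← r.eq, map_sum]

/-- `h₁ ⊗ h₂ S(h₃) = h ⊗ 1`. -/
theorem sum_comul_mul_one_tmul_antipode {ι : Type*} {h : H} (r : Coalgebra.Repr K h ι) :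
    ∑ i ∈ r.index, comul (R := K) (r.left i) * (1 ⊗ₜ antipode K (r.right i)) =
      h ⊗ₜ[K] (1 : H) := by
  let m : H ⊗[K] H →ₗ[K] H := mul' K H ∘ₗ lTensor H (antipode K)
  have key (t : H ⊗[K] H) (k : H) :
      t * (1 ⊗ₜ antipode K k) = lTensor H m (TensorProduct.assoc K H H H (t ⊗ₜ k)) := by
    induction t with
    | zero => simp
    | add a b ha hb => rw [add_mul, ha, hb, add_tmul, map_add, map_add]
    | tmul a b => simp [m]
  have hm : m ∘ₗ comul = Algebra.linearMap K H ∘ₗ counit :=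
    HopfAlgebra.mul_antipode_lTensor_comul
  calc _ = lTensor H m (TensorProduct.assoc K H H H (rTensor H comul (comul h))) := by
        simp [key, ← r.eq, map_sum]
    _ = lTensor H (m ∘ₗ comul) (comul h) := by
        rw [coassoc_apply, ← lTensor_comp_apply]
    _ = h ⊗ₜ 1 := by
        rw [hm, lTensor_comp_apply, lTensor_counit_comul]; simp

/-- If the antipode is involutive then `h₂ S(h₁) = ε(h) 1`. -/
theorem sum_mul_antipode_left_of_involutive
    (hS : ∀ x : H, antipode K (antipode K x) = x) {ι : Type*} {h : H}
    (r : Coalgebra.Repr K h ι) :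
    ∑ i ∈ r.index, r.right i * antipode K (r.left i) = algebraMap K H (counit h) := by
  rw [← hS (∑ i ∈ r.index, _), map_sum]
  simp only [antipode_mul_antidistrib, hS]
  rw [sum_mul_antipode_eq_smul, map_smul, antipode_one, Algebra.algebraMap_eq_smul_one]

/-- If the antipode is involutive then `h₁ ⊗ h₃ S(h₂) = h ⊗ 1`. -/
theorem sum_one_tmul_mul_lTensor_antipode_comul
    (hS : ∀ x : H, antipode K (antipode K x) = x) {ι : Type*} {h : H}
    (r : Coalgebra.Repr K h ι) :
    ∑ i ∈ r.index, (1 ⊗ₜ r.right i) * lTensor H (antipode K) (comul (R := K) (r.left i)) =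
      h ⊗ₜ[K] (1 : H) := by
  let m : H ⊗[K] H →ₗ[K] H :=
    mul' K H ∘ₗ (TensorProduct.comm K H H).toLinearMap ∘ₗ rTensor H (antipode K)
  have key (t : H ⊗[K] H) (k : H) :
      (1 ⊗ₜ k) * lTensor H (antipode K) t =
        lTensor H m (TensorProduct.assoc K H H H (t ⊗ₜ k)) := by
    induction t with
    | zero => simp
    | add a b ha hb => rw [map_add, mul_add, ha, hb, add_tmul, map_add, map_add]
    | tmul a b => simp [m]
  have hm : m ∘ₗ comul = Algebra.linearMap K H ∘ₗ counit := by
    ext a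
    rw [LinearMap.comp_apply, LinearMap.comp_apply (Algebra.linearMap K H), Algebra.linearMap_apply,
      ← sum_mul_antipode_left_of_involutive hS (ℛ K a)]
    conv_lhs => rw [← (ℛ K a).eq]
    simp [m, map_sum]
  calc _ = lTensor H m (TensorProduct.assoc K H H H (rTensor H comul (comul h))) := by
        simp [key, ← r.eq, map_sum]
    _ = lTensor H (m ∘ₗ comul) (comul h) := by
        rw [coassoc_apply, ← lTensor_comp_apply]
    _ = h ⊗ₜ 1 := by
        rw [hm, lTensor_comp_apply, lTensor_counit_comul]; simp

theorem sum_repr_mul_apply {ι : Type*} [Fintype ι] (b : Module.Basis ι K H)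
    (f : Module.Dual K H) (a c : H) : ∑ j, b.repr a j * f (b j * c) = f (a * c) := by
  have h := congrArg (fun y ↦ f (y * c)) (b.sum_repr a)
  simpa only [Finset.sum_mul, map_sum, smul_mul_assoc, map_smul, smul_eq_mul] using h

theorem sum_dualAct_mulLeft_dualAct {ι : Type*} [Fintype ι] (b : Module.Basis ι K H)
    (f : Module.Dual K H) (x h : H) :
    ∑ j, dualAct (b.coord j) (x * dualAct (f ∘ₗ mulLeft K (b j) ∘ₗ antipode K) h) =
      dualAct f x * h := by
  have hf (c : H) : ∑ j, f (b j * c) • b.coord j = f ∘ₗ mulRight K c := by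
    ext a
    simp [← sum_repr_mul_apply b f a c, mul_comm]
  have hact (y c : H) : ∑ j, f (b j * c) • dualAct (b.coord j) y =
      TensorProduct.rid K H (lTensor H f (comul y * (1 ⊗ₜ c))) := by
    have h1 : TensorProduct.rid K H (lTensor H f (comul y * (1 ⊗ₜ c))) =
        dualAct (f ∘ₗ mulRight K c) y := by
      rw [dualAct_apply, ← (ℛ K y).eq]
      simp [Finset.sum_mul, map_sum]
    rw [h1, ← hf, dualAct_eq_sum _ (ℛ K y)]
    simp only [dualAct_eq_sum _ (ℛ K y), Finset.smul_sum, LinearMap.sum_apply, Finset.sum_smul]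
    rw [Finset.sum_comm]
    simp [smul_smul]
  calc _ = ∑ i ∈ (ℛ K h).index, ∑ j, f (b j * antipode K ((ℛ K h).right i)) •
          dualAct (b.coord j) (x * (ℛ K h).left i) := by
        rw [Finset.sum_comm]
        simp [dualAct_eq_sum _ (ℛ K h), Finset.mul_sum, map_sum]
    _ = TensorProduct.rid K H (lTensor H f (comul x * ∑ i ∈ (ℛ K h).index,
          comul (R := K) ((ℛ K h).left i) * (1 ⊗ₜ antipode K ((ℛ K h).right i)))) := by
        simp [hact, Finset.mul_sum, map_sum, mul_assoc]
    _ = _ := by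
        rw [sum_comul_mul_one_tmul_antipode, dualAct_apply, ← (ℛ K x).eq]
        simp [Finset.sum_mul, map_sum]

theorem sum_dualAct_dualAct (hS : ∀ x : H, antipode K (antipode K x) = x)
    {ι : Type*} [Fintype ι] (b : Module.Basis ι K H) (f : Module.Dual K H) (h : H) :
    ∑ j, dualAct (f ∘ₗ mulLeft K (b j) ∘ₗ antipode K) (dualAct (b.coord j) h) = f 1 • h := by
  have hact (y c : H) :
      ∑ j, b.coord j c • dualAct (f ∘ₗ mulLeft K (b j) ∘ₗ antipode K) y =
      TensorProduct.rid K H (lTensor H f ((1 ⊗ₜ c) * lTensor H (antipode K) (comul y))) := by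
    have h1 : TensorProduct.rid K H
        (lTensor H f ((1 ⊗ₜ c) * lTensor H (antipode K) (comul y))) =
        dualAct (f ∘ₗ mulLeft K c ∘ₗ antipode K) y := by
      rw [dualAct_apply, ← (ℛ K y).eq]
      simp [Finset.mul_sum, map_sum]
    rw [h1, dualAct_eq_sum _ (ℛ K y)]
    simp only [dualAct_eq_sum _ (ℛ K y), Finset.smul_sum]
    rw [Finset.sum_comm]
    refine Finset.sum_congr rfl fun i _ ↦ ?_
    simp [← sum_repr_mul_apply b f c, smul_smul, Finset.sum_smul]
  calc _ = ∑ i ∈ (ℛ K h).index, ∑ j, b.coord j ((ℛ K h).right i) •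
          dualAct (f ∘ₗ mulLeft K (b j) ∘ₗ antipode K) ((ℛ K h).left i) := by
        rw [Finset.sum_comm]
        simp only [dualAct_eq_sum (b.coord _) (ℛ K h), map_sum, map_smul]
    _ = TensorProduct.rid K H (lTensor H f (∑ i ∈ (ℛ K h).index,
          (1 ⊗ₜ (ℛ K h).right i) *
            lTensor H (antipode K) (comul (R := K) ((ℛ K h).left i)))) := by
        simp only [hact, map_sum]
    _ = _ := by
        rw [sum_one_tmul_mul_lTensor_antipode_comul hS]
        simp

/-- The character of the regular representation is an integral: `χ(x₁) f(x₂) = f(1) χ(x)`. -/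
theorem trace_mulLeft_dualAct [FiniteDimensional K H]
    (hS : ∀ x : H, antipode K (antipode K x) = x)
    (f : Module.Dual K H) (x : H) :
    trace K H (mulLeft K (dualAct f x)) = f 1 * trace K H (mulLeft K x) := by
  let b := Module.finBasis K H
  let A j := dualAct (b.coord j)
  let B j := dualAct (f ∘ₗ mulLeft K (b j) ∘ₗ antipode K)
  have h1 : mulLeft K (dualAct f x) = ∑ j, A j * (mulLeft K x * B j) := by
    ext h
    simp [A, B, ← sum_dualAct_mulLeft_dualAct b f x h]
  have h2 : ∑ j, B j * A j = f 1 • (1 : Module.End K H) := by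
    ext h
    simp [A, B, sum_dualAct_dualAct hS b f h]
  calc _ = ∑ j, trace K H (mulLeft K x * (B j * A j)) := by
        rw [h1, map_sum]
        exact Finset.sum_congr rfl fun j _ ↦ by rw [trace_mul_comm, mul_assoc]
    _ = _ := by
        rw [← map_sum, ← Finset.mul_sum, h2, mul_smul_comm, mul_one, map_smul, smul_eq_mul]

end

/-- Let `H` be a finite-dimensional Hopf algebra over `ℂ` with involutive antipode and let
`φ ∈ H*` be a normalized two-sided integral functional (i.e. `φ(x₁)x₂ = φ(x)1 = x₁φ(x₂)` and
`φ(1) = 1`).  Then for every `x ∈ H` the trace of left multiplication by `x` equals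
`(dim_ℂ H) · φ(x)`. -/
theorem trace_mulLeft_eq_dim_mul_integral
    (H : Type*) [Ring H] [HopfAlgebra ℂ H] [FiniteDimensional ℂ H]
    (hS : ∀ x : H, HopfAlgebra.antipode (R := ℂ) (HopfAlgebra.antipode (R := ℂ) x) = x)
    (φ : Module.Dual ℂ H)
    (hφ_left : ∀ x : H,
      TensorProduct.lid ℂ H (LinearMap.rTensor H φ (Coalgebra.comul (R := ℂ) x)) = φ x • 1)
    (hφ_right : ∀ x : H,
      TensorProduct.rid ℂ H (LinearMap.lTensor H φ (Coalgebra.comul (R := ℂ) x)) = φ x • 1)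
    (hφ_one : φ 1 = 1)
    (x : H) :
    LinearMap.trace ℂ H (LinearMap.mulLeft ℂ x) = (Module.finrank ℂ H : ℂ) * φ x := by
  have h := trace_mulLeft_dualAct hS φ x
  rw [dualAct_apply, hφ_right, hφ_one, one_mul] at h
  rw [← h, show LinearMap.mulLeft ℂ (φ x • (1 : H)) = φ x • LinearMap.id by ext; simp,
    map_smul, LinearMap.trace_id, smul_eq_mul, mul_comm]
end

section
/- Let H be a finite-dimensional Hopf algebra over ℂ with involutive antipode (S∘S = id), let h ∈ H be a normalized two-sided integral, let φ ∈ H* be a normalized two-sided integral functional with φ(h) = 1/dim_ℂ H, let δ = √(dim_ℂ H), and suppose the Fourier transform F : H → H*, F(a) = δ·(b ↦ φ(ab)), is a linear isomorphism with inverse F⁻¹. Equip the vector space H* ⊗ H ⊗ H* with the iterated crossed product multiplication (f⊗x⊗g)(f'⊗x'⊗g') = f'₂(x₁) g₁(x'₂) (f f'₁ ⊗ x₂ x'₁ ⊗ g₂ g') (the crossed product H* ⋊ H ⋊ H*). Then the set S of elements of H* ⊗ H ⊗ H* that commute with ε ⊗ t ⊗ ε for every t ∈ H equals the image of the linear map H*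 ⊗ H* → H* ⊗ H ⊗ H* determined by f ⊗ g ↦ f₁ S(g₃) S(f₃) ⊗ F⁻¹(f₂ g₂) ⊗ S(g₁), this map is injective, and consequently dim_ℂ S = (dim_ℂ H)². -/
open TensorProduct

variable (H : Type*) [Ring H] [HopfAlgebra ℂ H]

/-- The convolution product on the dual of a coalgebra: `(conv f g)(x) = f(x₁)g(x₂)`. -/
noncomputable def conv (f g : Module.Dual ℂ H) : Module.Dual ℂ H :=
  (TensorProduct.lid ℂ ℂ).toLinearMap ∘ₗ TensorProduct.map f g ∘ₗ Coalgebra.comul (R := ℂ)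

/-- The antipode of the dual Hopf algebra `H*`: `S(f) = f ∘ S`. -/
noncomputable def dualAntipode (f : Module.Dual ℂ H) : Module.Dual ℂ H :=
  f ∘ₗ HopfAlgebra.antipode (R := ℂ)

namespace HopfAlgebra
open Coalgebra MulOpposite WithConv

variable {H}

section Involutive

variable (hS : ∀ x : H, antipode (R := ℂ) (antipode (R := ℂ) x) = x)
include hS

theorem sum_antipode_right_mul_left {ι : Type*} {t : H} (𝓡 : Coalgebra.Repr ℂ t ι) :
    ∑ i ∈ 𝓡.index, antipode ℂ (𝓡.right i) * 𝓡.left i = algebraMap ℂ H (counit t) := by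
  have := congrArg (antipode ℂ) (sum_antipode_mul_eq_algebraMap_counit 𝓡)
  simpa [antipode_mul_antidistrib, hS, Algebra.algebraMap_eq_smul_one] using this

theorem sum_right_mul_antipode_left {ι : Type*} {t : H} (𝓡 : Coalgebra.Repr ℂ t ι) :
    ∑ i ∈ 𝓡.index, 𝓡.right i * antipode ℂ (𝓡.left i) = algebraMap ℂ H (counit t) := by
  have := congrArg (antipode ℂ) (sum_mul_antipode_eq_algebraMap_counit 𝓡)
  simpa [antipode_mul_antidistrib, hS, Algebra.algebraMap_eq_smul_one] using this

theorem sum_antipode_right_mul_comul_left {ι : Type*} {t : H} (𝓡 : Coalgebra.Repr ℂ t ι) :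
    ∑ i ∈ 𝓡.index, (1 ⊗ₜ antipode ℂ (𝓡.right i)) * comul (R := ℂ) (𝓡.left i) =
      t ⊗ₜ[ℂ] (1 : H) := by
  let o : H ⊗[ℂ] H →ₗ[ℂ] (H ⊗[ℂ] H)ᵐᵒᵖ := (opLinearEquiv ℂ).toLinearMap
  let L : WithConv (H →ₗ[ℂ] (H ⊗[ℂ] H)ᵐᵒᵖ) :=
    toConv (o ∘ₗ (Algebra.TensorProduct.includeLeft : H →ₐ[ℂ] H ⊗[ℂ] H).toLinearMap)
  let R : WithConv (H →ₗ[ℂ] (H ⊗[ℂ] H)ᵐᵒᵖ) :=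
    toConv (o ∘ₗ (Algebra.TensorProduct.includeRight : H →ₐ[ℂ] H ⊗[ℂ] H).toLinearMap)
  let R' : WithConv (H →ₗ[ℂ] (H ⊗[ℂ] H)ᵐᵒᵖ) := toConv (R.ofConv ∘ₗ antipode ℂ)
  have hR : R * R' = 1 := by
    ext x
    apply unop_injective
    rw [(ℛ ℂ x).convMul_apply]
    simp [R, R', o, ← op_mul, ← TensorProduct.tmul_sum,
      sum_antipode_right_mul_left hS (ℛ ℂ x), Algebra.algebraMap_eq_smul_one]
    rfl
  have hLR : L * R = toConv (o ∘ₗ comul) := by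
    ext x
    apply unop_injective
    rw [(ℛ ℂ x).convMul_apply]
    simp [L, R, o, ← op_mul, (ℛ ℂ x).eq]
  have key : toConv (o ∘ₗ comul) * R' = L := by rw [← hLR, mul_assoc, hR, mul_one]
  have := congrArg unop (congr($key t))
  rw [𝓡.convMul_apply] at this
  simpa [L, R, R', o] using this

end Involutive

variable (H) in
/-- Right multiplication by `Δ(S(y))` as an algebra homomorphism in `y`. -/
noncomputable def mulRightComulAntipode : H →ₐ[ℂ] Module.End ℂ (H ⊗[ℂ] H) :=
  (Algebra.lsmul ℂ ℂ (H ⊗[ℂ] H)).comp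
    ((AlgHom.op (Bialgebra.comulAlgHom ℂ H)).comp (antipodeAlgHomOp ℂ H))

@[simp] theorem mulRightComulAntipode_apply (y : H) (x : H ⊗[ℂ] H) :
    mulRightComulAntipode H y x = x * comul (antipode ℂ y) := rfl

variable (H) in
/-- Left multiplication by `y ⊗ 1` as an algebra homomorphism in `y`. -/
noncomputable def mulLeftIncludeLeft : H →ₐ[ℂ] Module.End ℂ (H ⊗[ℂ] H) :=
  (Algebra.lmul ℂ (H ⊗[ℂ] H)).comp Algebra.TensorProduct.includeLeft

@[simp] theorem mulLeftIncludeLeft_apply (y : H) (x : H ⊗[ℂ] H) :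
    mulLeftIncludeLeft H y x = (y ⊗ₜ 1) * x := rfl

variable (H) in
/-- The action `y • x = (y₁ ⊗ 1) x Δ(S(y₂))` of `H` on `H ⊗ H`. -/
noncomputable def twistedAdjoint : H →ₐ[ℂ] Module.End ℂ (H ⊗[ℂ] H) :=
  (Algebra.TensorProduct.lift (mulLeftIncludeLeft H) (mulRightComulAntipode H) fun a _ =>
    LinearMap.ext fun x => (mul_assoc (a ⊗ₜ 1) x _).symm).comp (Bialgebra.comulAlgHom ℂ H)

theorem twistedAdjoint_eq_sum {ι : Type*} {y : H} (𝓡 : Coalgebra.Repr ℂ y ι) :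
    twistedAdjoint H y = ∑ i ∈ 𝓡.index,
      mulLeftIncludeLeft H (𝓡.left i) * mulRightComulAntipode H (𝓡.right i) := by
  rw [twistedAdjoint, AlgHom.comp_apply, Bialgebra.comulAlgHom_apply, ← 𝓡.eq, map_sum]
  exact Finset.sum_congr rfl fun i _ => Algebra.TensorProduct.lift_tmul _ _ _ _ _

theorem toConv_twistedAdjoint : toConv (twistedAdjoint H).toLinearMap =
    toConv (mulLeftIncludeLeft H).toLinearMap * toConv (mulRightComulAntipode H).toLinearMap := by
  ext y : 2
  rw [(ℛ ℂ y).convMul_apply]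
  exact twistedAdjoint_eq_sum (ℛ ℂ y)

theorem twistedAdjoint_apply {ι : Type*} {y : H} (𝓡 : Coalgebra.Repr ℂ y ι) (x : H ⊗[ℂ] H) :
    twistedAdjoint H y x =
      ∑ i ∈ 𝓡.index, (𝓡.left i ⊗ₜ 1) * x * comul (antipode ℂ (𝓡.right i)) := by
  simp [twistedAdjoint_eq_sum 𝓡, mul_assoc]

theorem twistedAdjoint_one_tmul_mul (y c : H) (x : H ⊗[ℂ] H) :
    twistedAdjoint H y ((1 ⊗ₜ c) * x) = (1 ⊗ₜ c) * twistedAdjoint H y x := by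
  simp only [twistedAdjoint_apply (ℛ ℂ y), Finset.mul_sum, ← mul_assoc]
  simp

/-- `Δ ∘ S` is the convolution of `1 ⊗ S` and `S ⊗ 1`. -/
theorem toConv_comul_comp_antipode :
    toConv (comul ∘ₗ antipode ℂ : H →ₗ[ℂ] H ⊗[ℂ] H) =
      toConv ((Algebra.TensorProduct.includeRight : H →ₐ[ℂ] H ⊗[ℂ] H).toLinearMap ∘ₗ antipode ℂ) *
      toConv ((Algebra.TensorProduct.includeLeft : H →ₐ[ℂ] H ⊗[ℂ] H).toLinearMap ∘ₗ
        antipode ℂ) := by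
  symm
  refine left_inv_eq_right_inv (a := toConv comul) ?_ LinearMap.comul_right_inv
  let L : WithConv (H →ₗ[ℂ] H ⊗[ℂ] H) :=
    toConv (Algebra.TensorProduct.includeLeft : H →ₐ[ℂ] H ⊗[ℂ] H).toLinearMap
  let R : WithConv (H →ₗ[ℂ] H ⊗[ℂ] H) :=
    toConv (Algebra.TensorProduct.includeRight : H →ₐ[ℂ] H ⊗[ℂ] H).toLinearMap
  have hLR : toConv comul = L * R := by
    ext x : 2
    rw [(ℛ ℂ x).convMul_apply]
    simp [L, R, (ℛ ℂ x).eq]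
  have inv (f : H →ₐ[ℂ] H ⊗[ℂ] H) :
      toConv (f.toLinearMap ∘ₗ antipode ℂ) * toConv f.toLinearMap = 1 := by
    ext x : 2
    rw [(ℛ ℂ x).convMul_apply]
    simp [← map_mul, ← map_sum, sum_antipode_mul_eq_algebraMap_counit (ℛ ℂ x)]
  rw [hLR, mul_assoc, ← mul_assoc _ L, inv, one_mul, inv]

theorem twistedAdjoint_apply' {ι κ : Type*} {y : H} (𝓡 : Coalgebra.Repr ℂ y ι)
    (𝓢 : (i : ι) → Coalgebra.Repr ℂ (𝓡.left i) κ) (x : H ⊗[ℂ] H) :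
    twistedAdjoint H y x = ∑ i ∈ 𝓡.index, ∑ j ∈ (𝓢 i).index,
      ((𝓢 i).left j ⊗ₜ 1) * x * (antipode ℂ (𝓡.right i) ⊗ₜ antipode ℂ ((𝓢 i).right j)) := by
  let mr : H ⊗[ℂ] H →ₗ[ℂ] Module.End ℂ (H ⊗[ℂ] H) := (LinearMap.mul ℂ (H ⊗[ℂ] H)).flip
  let A : WithConv (H →ₗ[ℂ] Module.End ℂ (H ⊗[ℂ] H)) := toConv (mr ∘ₗ
    (Algebra.TensorProduct.includeRight : H →ₐ[ℂ] H ⊗[ℂ] H).toLinearMap ∘ₗ antipode ℂ)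
  let B : WithConv (H →ₗ[ℂ] Module.End ℂ (H ⊗[ℂ] H)) := toConv (mr ∘ₗ
    (Algebra.TensorProduct.includeLeft : H →ₐ[ℂ] H ⊗[ℂ] H).toLinearMap ∘ₗ antipode ℂ)
  have hAB : toConv (mulRightComulAntipode H).toLinearMap = A * B := by
    ext y : 2
    refine LinearMap.ext fun x => ?_
    have := congr($(toConv_comul_comp_antipode (H := H)) y)
    rw [(ℛ ℂ y).convMul_apply] at this
    rw [(ℛ ℂ y).convMul_apply]
    simp at this
    simp [A, B, mr, this, Finset.mul_sum, mul_assoc]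
  have := toConv_twistedAdjoint (H := H)
  rw [hAB, ← mul_assoc] at this
  have := congr($this y)
  rw [𝓡.convMul_apply] at this
  simp only [(𝓢 _).convMul_apply] at this
  have := congr($this x)
  simpa [A, B, mr, Finset.sum_mul, mul_assoc] using this

theorem sum_twistedAdjoint_mul_comul
    (hS : ∀ x : H, antipode (R := ℂ) (antipode (R := ℂ) x) = x)
    {ι : Type*} {t : H} (𝓡 : Coalgebra.Repr ℂ t ι) (x : H ⊗[ℂ] H) :
    ∑ i ∈ 𝓡.index, twistedAdjoint H (𝓡.left i) (x * comul (𝓡.right i)) = (t ⊗ₜ 1) * x := by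
  let D : WithConv (H →ₗ[ℂ] Module.End ℂ (H ⊗[ℂ] H)) :=
    toConv ((LinearMap.mul ℂ (H ⊗[ℂ] H)).flip ∘ₗ comul)
  have inv : toConv (mulRightComulAntipode H).toLinearMap * D = 1 := by
    ext y : 2
    refine LinearMap.ext fun x => ?_
    rw [(ℛ ℂ y).convMul_apply]
    simp [D, mul_assoc, ← Finset.mul_sum, ← Bialgebra.comul_mul, ← map_sum,
      sum_right_mul_antipode_left hS (ℛ ℂ y), Algebra.algebraMap_eq_smul_one]
  have key : toConv (twistedAdjoint H).toLinearMap * D =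
      toConv (mulLeftIncludeLeft H).toLinearMap := by
    rw [toConv_twistedAdjoint, mul_assoc, inv, mul_one]
  have := congr($key t)
  rw [𝓡.convMul_apply] at this
  have := congr($this x)
  simpa [D] using this

theorem sum_comul_left_mul_antipode_right {ι : Type*} {t : H} (𝓡 : Coalgebra.Repr ℂ t ι) :
    ∑ i ∈ 𝓡.index, comul (R := ℂ) (𝓡.left i) * (1 ⊗ₜ antipode ℂ (𝓡.right i)) =
      t ⊗ₜ[ℂ] (1 : H) := by
  let L : WithConv (H →ₗ[ℂ] H ⊗[ℂ] H) :=
    toConv (Algebra.TensorProduct.includeLeft : H →ₐ[ℂ] H ⊗[ℂ] H).toLinearMap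
  let R : WithConv (H →ₗ[ℂ] H ⊗[ℂ] H) :=
    toConv (Algebra.TensorProduct.includeRight : H →ₐ[ℂ] H ⊗[ℂ] H).toLinearMap
  let R' : WithConv (H →ₗ[ℂ] H ⊗[ℂ] H) := toConv (R.ofConv ∘ₗ antipode ℂ)
  have hR : R * R' = 1 := by
    ext x : 2
    rw [(ℛ ℂ x).convMul_apply]
    simp [R, R', ← TensorProduct.tmul_sum, sum_mul_antipode_eq_algebraMap_counit (ℛ ℂ x),
      Algebra.algebraMap_eq_smul_one]
    rfl
  have hLR : L * R = toConv comul := by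
    ext x : 2
    rw [(ℛ ℂ x).convMul_apply]
    simp [L, R, (ℛ ℂ x).eq]
  have key : toConv comul * R' = L := by rw [← hLR, mul_assoc, hR, mul_one]
  have := congr($key t)
  rw [𝓡.convMul_apply] at this
  simpa [L, R, R'] using this

section Integral

variable {h : H}

theorem comul_integral_mul_tmul_one
    (hh_right : ∀ x : H, h * x = counit (R := ℂ) x • h) (a : H) :
    comul h * (a ⊗ₜ 1) = comul (R := ℂ) h * (1 ⊗ₜ antipode ℂ a) := by
  have ha : ∑ i ∈ (ℛ ℂ a).index, counit (R := ℂ) ((ℛ ℂ a).left i) • (ℛ ℂ a).right i = a :=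
    sum_counit_smul _
  rw [← sum_comul_left_mul_antipode_right (ℛ ℂ a), Finset.mul_sum]
  conv_rhs => rw [← ha]
  simp only [← mul_assoc, ← Bialgebra.comul_mul, hh_right, map_smul, map_sum,
    TensorProduct.tmul_sum, TensorProduct.tmul_smul, Finset.mul_sum, mul_smul_comm, smul_mul_assoc]

theorem tmul_one_mul_comul_integral
    (hS : ∀ x : H, antipode (R := ℂ) (antipode (R := ℂ) x) = x)
    (hh_left : ∀ x : H, x * h = counit (R := ℂ) x • h) (a : H) :
    (a ⊗ₜ 1) * comul h = (1 ⊗ₜ antipode ℂ a) * comul (R := ℂ) h := by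
  have ha : ∑ i ∈ (ℛ ℂ a).index, counit (R := ℂ) ((ℛ ℂ a).left i) • (ℛ ℂ a).right i = a :=
    sum_counit_smul _
  rw [← sum_antipode_right_mul_comul_left hS (ℛ ℂ a), Finset.sum_mul]
  conv_rhs => rw [← ha]
  simp only [mul_assoc, ← Bialgebra.comul_mul, hh_left, map_smul, map_sum,
    TensorProduct.tmul_sum, TensorProduct.tmul_smul, Finset.sum_mul, mul_smul_comm, smul_mul_assoc]

/-- A two-sided integral functional that does not vanish on a two-sided integral is a trace,
provided the antipode is involutive. -/
theorem integral_mul_comm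
    (hS : ∀ x : H, antipode (R := ℂ) (antipode (R := ℂ) x) = x)
    (hh_left : ∀ x : H, x * h = counit (R := ℂ) x • h)
    (hh_right : ∀ x : H, h * x = counit (R := ℂ) x • h)
    {φ : Module.Dual ℂ H}
    (hφ_left : ∀ x : H,
      TensorProduct.lid ℂ H (LinearMap.rTensor H φ (comul (R := ℂ) x)) = φ x • 1)
    (hφ_right : ∀ x : H,
      TensorProduct.rid ℂ H (LinearMap.lTensor H φ (comul (R := ℂ) x)) = φ x • 1)
    (hφh : φ h ≠ 0) (a b : H) : φ (a * b) = φ (b * a) := by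
  have hl := hφ_left h
  have hr := hφ_right h
  let 𝓗 := ℛ ℂ h
  rw [← 𝓗.eq] at hl hr
  simp only [map_sum, LinearMap.rTensor_tmul, TensorProduct.lid_tmul, LinearMap.lTensor_tmul,
    TensorProduct.rid_tmul] at hl hr
  have e1 (a : H) : ∑ i ∈ 𝓗.index, φ (𝓗.left i * a) • 𝓗.right i = φ h • antipode ℂ a := by
    have := congrArg (fun x => TensorProduct.lid ℂ H (LinearMap.rTensor H φ x))
      (comul_integral_mul_tmul_one hh_right a)
    have hl' := congrArg (· * antipode ℂ a) hl
    simp only [Finset.sum_mul, smul_mul_assoc, one_mul] at hl'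
    simpa [← 𝓗.eq, Finset.sum_mul, hl'] using this
  have e2 (a : H) : ∑ i ∈ 𝓗.index, φ (a * 𝓗.left i) • 𝓗.right i = φ h • antipode ℂ a := by
    have := congrArg (fun x => TensorProduct.lid ℂ H (LinearMap.rTensor H φ x))
      (tmul_one_mul_comul_integral hS hh_left a)
    have hl' := congrArg (antipode ℂ a * ·) hl
    simp only [Finset.mul_sum, mul_smul_comm, mul_one] at hl'
    simpa [← 𝓗.eq, Finset.mul_sum, hl'] using this
  have e3 (a : H) : ∑ i ∈ 𝓗.index, φ (𝓗.right i * antipode ℂ a) • 𝓗.left i = φ h • a := by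
    have := congrArg (fun x => TensorProduct.rid ℂ H (LinearMap.lTensor H φ x))
      (comul_integral_mul_tmul_one hh_right a)
    have hr' := congrArg (· * a) hr
    simp only [Finset.sum_mul, smul_mul_assoc, one_mul] at hr'
    simpa [← 𝓗.eq, Finset.sum_mul, hr'] using this.symm
  apply mul_left_cancel₀ hφh
  have l := congrArg (fun x => φ (a * x)) (e3 b)
  have r := congrArg (fun x => φ (x * a)) (e3 b)
  have l' := congrArg (fun x => φ (x * antipode ℂ b)) (e2 a)
  have r' := congrArg (fun x => φ (x * antipode ℂ b)) (e1 a)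
  simp only [Finset.mul_sum, Finset.sum_mul, map_sum, mul_smul_comm, smul_mul_assoc, map_smul,
    smul_eq_mul] at l r l' r'
  rw [← l, ← r]
  simp only [mul_comm (φ (𝓗.right _ * _))]
  rw [l', r']

end Integral

section Equivariant

variable (H) in
/-- The linear map `b ⊗ z ↦ (1 ⊗ S(z)) Δ(b)`. -/
noncomputable def antipodeMulComul : H ⊗[ℂ] H →ₗ[ℂ] H ⊗[ℂ] H :=
  TensorProduct.lift ((LinearMap.mul ℂ (H ⊗[ℂ] H)).compl₁₂
    ((Algebra.TensorProduct.includeRight : H →ₐ[ℂ] H ⊗[ℂ] H).toLinearMap ∘ₗ antipode ℂ)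
    comul).flip

@[simp] theorem antipodeMulComul_tmul (b z : H) :
    antipodeMulComul H (b ⊗ₜ z) = (1 ⊗ₜ antipode ℂ z) * comul b := by
  simp [antipodeMulComul]

variable (H) in
/-- The linear map `y ⊗ b ⊗ z ↦ (1 ⊗ S(z)) (y₁ ⊗ 1) Δ(b) Δ(S(y₂))`. -/
noncomputable def twistedAdjointMul : H ⊗[ℂ] (H ⊗[ℂ] H) →ₗ[ℂ] H ⊗[ℂ] H :=
  TensorProduct.lift
    ((LinearMap.lcomp ℂ (H ⊗[ℂ] H) (antipodeMulComul H)) ∘ₗ (twistedAdjoint H).toLinearMap)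

@[simp] theorem twistedAdjointMul_tmul (y : H) (x : H ⊗[ℂ] H) :
    twistedAdjointMul H (y ⊗ₜ x) = twistedAdjoint H y (antipodeMulComul H x) := by
  simp [twistedAdjointMul]

theorem antipodeMulComul_surjective
    (hS : ∀ x : H, antipode (R := ℂ) (antipode (R := ℂ) x) = x) :
    Function.Surjective (antipodeMulComul H) := by
  rw [← LinearMap.range_eq_top, ← top_le_iff, ← TensorProduct.span_tmul_eq_top,
    Submodule.span_le]
  rintro _ ⟨a, c, rfl⟩
  refine ⟨∑ i ∈ (ℛ ℂ a).index, (ℛ ℂ a).left i ⊗ₜ antipode ℂ (c * antipode ℂ ((ℛ ℂ a).right i)), ?_⟩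
  have := congrArg ((1 ⊗ₜ c) * ·) (sum_antipode_right_mul_comul_left hS (ℛ ℂ a))
  simpa [hS, Finset.mul_sum, ← mul_assoc] using this

/-- The condition satisfied by `V(y, b, z) = f(y) φ(xb) g(z)` when `f ⊗ x ⊗ g` commutes with
the middle copy of `H`. -/
def IsMiddleEquivariant (V : Module.Dual ℂ (H ⊗[ℂ] (H ⊗[ℂ] H))) : Prop :=
  ∀ t y b z : H,
    ∑ i ∈ (ℛ ℂ t).index, V (y ⊗ₜ (((ℛ ℂ t).left i * b) ⊗ₜ ((ℛ ℂ t).right i * z))) =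
      ∑ i ∈ (ℛ ℂ t).index, V ((y * (ℛ ℂ t).left i) ⊗ₜ ((b * (ℛ ℂ t).right i) ⊗ₜ z))

variable (hS : ∀ x : H, antipode (R := ℂ) (antipode (R := ℂ) x) = x)
include hS

theorem isMiddleEquivariant_comp_twistedAdjointMul (u : Module.Dual ℂ (H ⊗[ℂ] H)) :
    IsMiddleEquivariant (u ∘ₗ twistedAdjointMul H) := by
  intro t y b z
  simp only [LinearMap.comp_apply, twistedAdjointMul_tmul, map_mul, Module.End.mul_apply,
    antipodeMulComul_tmul]
  simp only [← map_sum]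
  congr 2
  have h1 : ∑ i ∈ (ℛ ℂ t).index, (1 ⊗ₜ antipode ℂ z) *
      ((1 ⊗ₜ antipode ℂ ((ℛ ℂ t).right i)) * comul (R := ℂ) ((ℛ ℂ t).left i)) * comul b =
      (1 ⊗ₜ antipode ℂ z) * (t ⊗ₜ[ℂ] (1 : H)) * comul b := by
    rw [← Finset.sum_mul, ← Finset.mul_sum, sum_antipode_right_mul_comul_left hS]
  have h2 := sum_twistedAdjoint_mul_comul hS (ℛ ℂ t) ((1 ⊗ₜ antipode ℂ z) * comul b)
  simp only [Bialgebra.comul_mul, antipode_mul_antidistrib, ← mul_assoc] at h1 h2 ⊢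
  simpa [h2] using h1

theorem IsMiddleEquivariant.eq_zero {V : Module.Dual ℂ (H ⊗[ℂ] (H ⊗[ℂ] H))}
    (hV : IsMiddleEquivariant V) (h0 : ∀ x : H ⊗[ℂ] H, V (1 ⊗ₜ x) = 0) : V = 0 := by
  have key (t b z : H) : V (t ⊗ₜ (b ⊗ₜ z)) = 0 := by
    let Vz : H ⊗[ℂ] H →ₗ[ℂ] ℂ :=
      V ∘ₗ LinearMap.lTensor H ((TensorProduct.mk ℂ H H).flip z)
    have hVz (t b : H) : Vz ((1 ⊗ₜ b) * comul t) = 0 := by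
      have := hV t 1 b z
      simp only [h0, Finset.sum_const_zero] at this
      rw [← (ℛ ℂ t).eq]
      simpa [Finset.mul_sum, Vz] using this.symm
    have := congrArg (fun x => Vz ((1 ⊗ₜ b) * x)) (sum_antipode_right_mul_comul_left hS (ℛ ℂ t))
    simp only [Finset.mul_sum, map_sum, ← mul_assoc, Algebra.TensorProduct.tmul_mul_tmul, one_mul,
      mul_one, hVz, Finset.sum_const_zero] at this
    simpa [Vz] using this.symm
  ext t b z
  exact key t b z

theorem isMiddleEquivariant_iff [FiniteDimensional ℂ H]
    (V : Module.Dual ℂ (H ⊗[ℂ] (H ⊗[ℂ] H))) :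
    IsMiddleEquivariant V ↔ ∃ u : Module.Dual ℂ (H ⊗[ℂ] H), u ∘ₗ twistedAdjointMul H = V := by
  refine ⟨fun hV => ?_, ?_⟩
  · have hsurj := antipodeMulComul_surjective hS
    let e := LinearEquiv.ofBijective (antipodeMulComul H)
      ⟨LinearMap.injective_iff_surjective.mpr hsurj, hsurj⟩
    let u : Module.Dual ℂ (H ⊗[ℂ] H) :=
      (V ∘ₗ TensorProduct.mk ℂ H (H ⊗[ℂ] H) 1) ∘ₗ e.symm.toLinearMap
    refine ⟨u, sub_eq_zero.mp ?_⟩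
    refine IsMiddleEquivariant.eq_zero hS (fun t y b z => ?_) fun x => ?_
    · simpa [Finset.sum_sub_distrib] using
        congrArg₂ (· - ·) (isMiddleEquivariant_comp_twistedAdjointMul hS u t y b z) (hV t y b z)
    · have : e.symm (antipodeMulComul H x) = x := e.symm_apply_apply x
      simp [u, this]
  · rintro ⟨u, rfl⟩
    exact isMiddleEquivariant_comp_twistedAdjointMul hS u

theorem comp_twistedAdjointMul_injective :
    Function.Injective fun u : Module.Dual ℂ (H ⊗[ℂ] H) => u ∘ₗ twistedAdjointMul H := by
  intro u v huv
  refine LinearMap.ext fun x => ?_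
  obtain ⟨x, rfl⟩ := antipodeMulComul_surjective hS x
  simpa using congr($huv (1 ⊗ₜ x))

end Equivariant

section Dual

variable (H) in
theorem exists_sum_mul_eq [FiniteDimensional ℂ H] (f : Module.Dual ℂ H) :
    ∃ (n : ℕ) (f₁ f₂ : Fin n → Module.Dual ℂ H), ∀ a b, ∑ j, f₁ j a * f₂ j b = f (a * b) := by
  let e := Module.finBasis ℂ H
  refine ⟨_, e.coord, fun j => f ∘ₗ LinearMap.mulLeft ℂ (e j), fun a b => ?_⟩
  conv_rhs => rw [← e.sum_repr a]
  simp only [Finset.sum_mul, map_sum, smul_mul_assoc, map_smul, smul_eq_mul]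
  rfl

variable (H) in
theorem exists_sum_mul_mul_eq [FiniteDimensional ℂ H] (f : Module.Dual ℂ H) :
    ∃ (n : ℕ) (f₁ f₂ f₃ : Fin n × Fin n → Module.Dual ℂ H),
      ∀ a b c, ∑ j, f₁ j a * f₂ j b * f₃ j c = f (a * b * c) := by
  let e := Module.finBasis ℂ H
  refine ⟨_, fun j => e.coord j.1, fun j => e.coord j.2,
    fun j => f ∘ₗ LinearMap.mulLeft ℂ (e j.1 * e j.2), fun a b c => ?_⟩
  conv_rhs => rw [← e.sum_repr a, ← e.sum_repr b]
  simp only [Finset.sum_mul, Finset.mul_sum, map_sum, smul_mul_assoc, mul_smul_comm, map_smul,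
    smul_eq_mul, Fintype.sum_prod_type]
  simp only [mul_assoc]
  rw [Finset.sum_comm]
  refine Finset.sum_congr rfl fun i _ => Finset.sum_congr rfl fun j _ => ?_
  simp only [Module.Basis.coord_apply, LinearMap.comp_apply, LinearMap.mulLeft_apply, mul_assoc]
  ring

theorem exists_repr_fin (x : H) : ∃ n, Nonempty (Coalgebra.Repr ℂ x (Fin n)) :=
  let ⟨n, l, r, e⟩ := TensorProduct.exists_sum_tmul_eq (comul (R := ℂ) x)
  ⟨n, ⟨⟨Finset.univ, l, r, e.symm⟩⟩⟩

theorem conv_apply {ι : Type*} {x : H} (𝓡 : Coalgebra.Repr ℂ x ι) (f g : Module.Dual ℂ H) :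
    conv H f g x = ∑ i ∈ 𝓡.index, f (𝓡.left i) * g (𝓡.right i) := by
  simp [conv, ← 𝓡.eq]

theorem sum_counit_right_smul {ι : Type*} {x : H} (𝓡 : Coalgebra.Repr ℂ x ι) :
    ∑ i ∈ 𝓡.index, counit (R := ℂ) (𝓡.right i) • 𝓡.left i = x := by
  have := congrArg (TensorProduct.rid ℂ H) (sum_tmul_counit_eq 𝓡)
  simpa only [map_sum, TensorProduct.rid_tmul, one_smul] using this

@[simp] theorem conv_counit (f : Module.Dual ℂ H) : conv H f counit = f := by
  ext x
  simpa [conv_apply (ℛ ℂ x), mul_comm] using congrArg f (sum_counit_right_smul (ℛ ℂ x))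

@[simp] theorem counit_conv (f : Module.Dual ℂ H) : conv H counit f = f := by
  ext x
  simpa [conv_apply (ℛ ℂ x)] using congrArg f (sum_counit_smul (ℛ ℂ x))

/-- The identification `f ⊗ x ⊗ g ↦ (y ⊗ b ⊗ z ↦ f(y) F(x)(b) g(z))`. -/
noncomputable def tripleDualEquiv [FiniteDimensional ℂ H] (F : H ≃ₗ[ℂ] Module.Dual ℂ H) :
    Module.Dual ℂ H ⊗[ℂ] (H ⊗[ℂ] Module.Dual ℂ H) ≃ₗ[ℂ]
      Module.Dual ℂ (H ⊗[ℂ] (H ⊗[ℂ] H)) :=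
  TensorProduct.congr (LinearEquiv.refl ℂ _)
    (TensorProduct.congr F (LinearEquiv.refl ℂ _) ≪≫ₗ TensorProduct.dualDistribEquiv ℂ H H) ≪≫ₗ
    TensorProduct.dualDistribEquiv ℂ H (H ⊗[ℂ] H)

@[simp] theorem tripleDualEquiv_tmul [FiniteDimensional ℂ H] (F : H ≃ₗ[ℂ] Module.Dual ℂ H)
    (f g : Module.Dual ℂ H) (x y b z : H) :
    tripleDualEquiv F (f ⊗ₜ (x ⊗ₜ g)) (y ⊗ₜ (b ⊗ₜ z)) = f y * (F x b * g z) := rfl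

theorem sum_comm_triple {α β γ κ M : Type*} [AddCommMonoid M] (A : Finset α)
    (B : α → Finset β) (C : Finset γ) (I : Finset κ) (T : α → β → γ → κ → M) :
    ∑ k ∈ A, ∑ m ∈ B k, ∑ n ∈ C, ∑ i ∈ I, T k m n i =
      ∑ i ∈ I, ∑ k ∈ A, ∑ m ∈ B k, ∑ n ∈ C, T k m n i := by
  rw [Finset.sum_comm (s := I)]
  refine Finset.sum_congr rfl fun k _ => ?_
  rw [Finset.sum_comm (s := I)]
  exact Finset.sum_congr rfl fun m _ => Finset.sum_comm

theorem dualDistrib_twistedAdjointMul {α β : Type*} (f g : Module.Dual ℂ H)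
    (s : Finset α) (t : Finset β)
    (f₁ f₂ f₃ : α → Module.Dual ℂ H) (g₁ g₂ g₃ : β → Module.Dual ℂ H)
    (hf : ∀ a b c : H, ∑ i ∈ s, f₁ i a * f₂ i b * f₃ i c = f (a * b * c))
    (hg : ∀ a b c : H, ∑ j ∈ t, g₁ j a * g₂ j b * g₃ j c = g (a * b * c)) (y b z : H) :
    TensorProduct.dualDistrib ℂ H H (f ⊗ₜ g) (twistedAdjointMul H (y ⊗ₜ (b ⊗ₜ z))) =
      ∑ i ∈ s, ∑ j ∈ t,
        conv H (conv H (f₁ i) (dualAntipode H (g₃ j))) (dualAntipode H (f₃ i)) y *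
          (conv H (f₂ i) (g₂ j) b * dualAntipode H (g₁ j) z) := by
  have hE : twistedAdjointMul H (y ⊗ₜ (b ⊗ₜ z)) = ∑ k ∈ (ℛ ℂ y).index,
      ∑ m ∈ (ℛ ℂ ((ℛ ℂ y).left k)).index, ∑ n ∈ (ℛ ℂ b).index,
        ((ℛ ℂ ((ℛ ℂ y).left k)).left m * (ℛ ℂ b).left n * antipode ℂ ((ℛ ℂ y).right k)) ⊗ₜ
        (antipode ℂ z * (ℛ ℂ b).right n * antipode ℂ ((ℛ ℂ ((ℛ ℂ y).left k)).right m)) := by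
    rw [twistedAdjointMul_tmul, antipodeMulComul_tmul,
      twistedAdjoint_apply' (ℛ ℂ y) fun k => ℛ ℂ ((ℛ ℂ y).left k), ← (ℛ ℂ b).eq]
    simp [Finset.mul_sum, Finset.sum_mul]
  simp only [hE, map_sum, TensorProduct.dualDistrib_apply, ← hf, ← hg, Finset.sum_mul_sum]
  rw [sum_comm_triple]
  refine Finset.sum_congr rfl fun i _ => ?_
  rw [sum_comm_triple]
  refine Finset.sum_congr rfl fun j _ => ?_
  rw [conv_apply (ℛ ℂ y), Finset.sum_mul]
  refine Finset.sum_congr rfl fun k _ => ?_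
  rw [conv_apply (ℛ ℂ ((ℛ ℂ y).left k)), Finset.sum_mul, Finset.sum_mul]
  refine Finset.sum_congr rfl fun m _ => ?_
  rw [conv_apply (ℛ ℂ b), Finset.sum_mul, Finset.mul_sum]
  refine Finset.sum_congr rfl fun n _ => ?_
  simp only [dualAntipode, LinearMap.comp_apply]
  ring

end Dual


/-- A linear functional takes the same value on all presentations of a coproduct. -/
theorem sum_repr_eq {ι κ : Type*} {t : H} (𝓡 : Coalgebra.Repr ℂ t ι) (𝓡' : Coalgebra.Repr ℂ t κ)
    (L : Module.Dual ℂ (H ⊗[ℂ] H)) :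
    ∑ i ∈ 𝓡.index, L (𝓡.left i ⊗ₜ 𝓡.right i) = ∑ i ∈ 𝓡'.index, L (𝓡'.left i ⊗ₜ 𝓡'.right i) := by
  rw [← map_sum, ← map_sum, 𝓡.eq, 𝓡'.eq]

end HopfAlgebra

open HopfAlgebra Coalgebra

/-- Let `H` be a finite-dimensional Hopf algebra over `ℂ` with involutive antipode, `h` a
normalized two-sided integral, `φ` a normalized two-sided integral functional with
`φ(h) = 1/dim H`, `δ = √(dim H)`, and suppose the Fourier transform `F(a) = δ·φ(a·–)` is a
linear isomorphism.  Equip `H* ⊗ H ⊗ H*` with the iterated crossed product multiplication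
`(f⊗x⊗g)(f'⊗x'⊗g') = f'₂(x₁)g₁(x'₂)(ff'₁ ⊗ x₂x'₁ ⊗ g₂g')`.  Then the set `S` of elements
commuting with `ε ⊗ t ⊗ ε` for every `t ∈ H` equals the image of the injective linear map
`H* ⊗ H* → H* ⊗ H ⊗ H*`, `f ⊗ g ↦ f₁S(g₃)S(f₃) ⊗ F⁻¹(f₂g₂) ⊗ S(g₁)`; consequently
`dim_ℂ S = (dim_ℂ H)²`. -/
theorem commutant_of_middle_eq_range
    [FiniteDimensional ℂ H]
    (hS : ∀ x : H, HopfAlgebra.antipode (R := ℂ) (HopfAlgebra.antipode (R := ℂ) x) = x)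
    (h : H)
    (hh_left : ∀ x : H, x * h = Coalgebra.counit (R := ℂ) x • h)
    (hh_right : ∀ x : H, h * x = Coalgebra.counit (R := ℂ) x • h)
    (hh_one : Coalgebra.counit (R := ℂ) h = 1)
    (φ : Module.Dual ℂ H)
    (hφ_left : ∀ x : H,
      TensorProduct.lid ℂ H (LinearMap.rTensor H φ (Coalgebra.comul (R := ℂ) x)) = φ x • 1)
    (hφ_right : ∀ x : H,
      TensorProduct.rid ℂ H (LinearMap.lTensor H φ (Coalgebra.comul (R := ℂ) x)) = φ x • 1)
    (hφ_one : φ 1 = 1)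
    (hφh : φ h = 1 / (Module.finrank ℂ H : ℂ))
    (δ : ℂ) (hδ : δ = (Real.sqrt (Module.finrank ℂ H) : ℂ))
    (F : H ≃ₗ[ℂ] Module.Dual ℂ H)
    (hF : ∀ a b : H, F a b = δ * φ (a * b))
    (mul : (Module.Dual ℂ H ⊗[ℂ] (H ⊗[ℂ] Module.Dual ℂ H)) →ₗ[ℂ]
      (Module.Dual ℂ H ⊗[ℂ] (H ⊗[ℂ] Module.Dual ℂ H)) →ₗ[ℂ]
      (Module.Dual ℂ H ⊗[ℂ] (H ⊗[ℂ] Module.Dual ℂ H)))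
    (hmul : ∀ (f g f' g' : Module.Dual ℂ H) (x x' : H)
        (ι ι' κ μ : Type) (s : Finset ι) (s' : Finset ι') (t : Finset κ) (r : Finset μ)
        (x₁ x₂ : ι → H) (x'₁ x'₂ : ι' → H)
        (f'₁ f'₂ : κ → Module.Dual ℂ H) (g₁ g₂ : μ → Module.Dual ℂ H),
      Coalgebra.comul (R := ℂ) x = ∑ i ∈ s, x₁ i ⊗ₜ[ℂ] x₂ i →
      Coalgebra.comul (R := ℂ) x' = ∑ i ∈ s', x'₁ i ⊗ₜ[ℂ] x'₂ i →
      (∀ a b : H, ∑ j ∈ t, f'₁ j a * f'₂ j b = f' (a * b)) →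
      (∀ a b : H, ∑ k ∈ r, g₁ k a * g₂ k b = g (a * b)) →
      mul (f ⊗ₜ[ℂ] (x ⊗ₜ[ℂ] g)) (f' ⊗ₜ[ℂ] (x' ⊗ₜ[ℂ] g')) =
        ∑ i ∈ s, ∑ i' ∈ s', ∑ j ∈ t, ∑ k ∈ r,
          (f'₂ j (x₁ i) * g₁ k (x'₂ i')) •
            (conv H f (f'₁ j) ⊗ₜ[ℂ] ((x₂ i * x'₁ i') ⊗ₜ[ℂ] conv H (g₂ k) g')))
    (Ψ : (Module.Dual ℂ H ⊗[ℂ] Module.Dual ℂ H) →ₗ[ℂ]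
      (Module.Dual ℂ H ⊗[ℂ] (H ⊗[ℂ] Module.Dual ℂ H)))
    (hΨ : ∀ (f g : Module.Dual ℂ H) (ι κ : Type) (s : Finset ι) (t : Finset κ)
        (f₁ f₂ f₃ : ι → Module.Dual ℂ H) (g₁ g₂ g₃ : κ → Module.Dual ℂ H),
      (∀ a b c : H, ∑ i ∈ s, f₁ i a * f₂ i b * f₃ i c = f (a * b * c)) →
      (∀ a b c : H, ∑ j ∈ t, g₁ j a * g₂ j b * g₃ j c = g (a * b * c)) →
      Ψ (f ⊗ₜ[ℂ] g) = ∑ i ∈ s, ∑ j ∈ t,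
        conv H (conv H (f₁ i) (dualAntipode H (g₃ j))) (dualAntipode H (f₃ i)) ⊗ₜ[ℂ]
          (F.symm (conv H (f₂ i) (g₂ j)) ⊗ₜ[ℂ] dualAntipode H (g₁ j))) :
    {w : Module.Dual ℂ H ⊗[ℂ] (H ⊗[ℂ] Module.Dual ℂ H) | ∀ t : H,
        mul w ((Coalgebra.counit (R := ℂ) : Module.Dual ℂ H) ⊗ₜ[ℂ]
          (t ⊗ₜ[ℂ] (Coalgebra.counit (R := ℂ) : Module.Dual ℂ H))) =
        mul ((Coalgebra.counit (R := ℂ) : Module.Dual ℂ H) ⊗ₜ[ℂ]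
          (t ⊗ₜ[ℂ] (Coalgebra.counit (R := ℂ) : Module.Dual ℂ H))) w} = Set.range Ψ ∧
    Function.Injective Ψ ∧
    Set.finrank ℂ
      {w : Module.Dual ℂ H ⊗[ℂ] (H ⊗[ℂ] Module.Dual ℂ H) | ∀ t : H,
        mul w ((Coalgebra.counit (R := ℂ) : Module.Dual ℂ H) ⊗ₜ[ℂ]
          (t ⊗ₜ[ℂ] (Coalgebra.counit (R := ℂ) : Module.Dual ℂ H))) =
        mul ((Coalgebra.counit (R := ℂ) : Module.Dual ℂ H) ⊗ₜ[ℂ]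
          (t ⊗ₜ[ℂ] (Coalgebra.counit (R := ℂ) : Module.Dual ℂ H))) w} =
      Module.finrank ℂ H ^ 2 := by
  have hh_ne : h ≠ 0 := fun h0 => by simp [h0] at hh_one
  have : Nontrivial H := ⟨h, 0, hh_ne⟩
  have hφh_ne : φ h ≠ 0 := by
    rw [hφh]
    exact one_div_ne_zero (Nat.cast_ne_zero.mpr Module.finrank_pos.ne')
  have htr := integral_mul_comm hS hh_left hh_right hφ_left hφ_right hφh_ne
  let Θ := tripleDualEquiv F
  have hΘΨ : ∀ u, Θ (Ψ u) =
      TensorProduct.dualDistribEquiv ℂ H H u ∘ₗ twistedAdjointMul H := by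
    intro u
    induction u with
    | zero => simp
    | add u v hu hv => rw [map_add, map_add, hu, hv, map_add, LinearMap.add_comp]
    | tmul f g =>
      obtain ⟨n, f₁, f₂, f₃, hf⟩ := exists_sum_mul_mul_eq H f
      obtain ⟨m, g₁, g₂, g₃, hg⟩ := exists_sum_mul_mul_eq H g
      rw [hΨ f g _ _ _ _ f₁ f₂ f₃ g₁ g₂ g₃ hf hg]
      refine TensorProduct.ext_threefold' fun y b z => ?_
      refine Eq.trans ?_
        (dualDistrib_twistedAdjointMul f g _ _ f₁ f₂ f₃ g₁ g₂ g₃ hf hg y b z).symm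
      simp [Θ]
  have hright : ∀ w (t y b z : H),
      Θ (mul w ((counit (R := ℂ) : Module.Dual ℂ H) ⊗ₜ[ℂ]
        (t ⊗ₜ[ℂ] (counit (R := ℂ) : Module.Dual ℂ H)))) (y ⊗ₜ (b ⊗ₜ z)) =
      ∑ i ∈ (ℛ ℂ t).index, Θ w (y ⊗ₜ (((ℛ ℂ t).left i * b) ⊗ₜ ((ℛ ℂ t).right i * z))) := by
    intro w t y b z
    induction w using TensorProduct.induction_on with
    | zero => simp
    | add u v hu hv => simp [hu, hv, Finset.sum_add_distrib]
    | tmul f v =>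
    induction v using TensorProduct.induction_on with
    | zero => simp
    | add u v hu hv => simp [hu, hv, Finset.sum_add_distrib, TensorProduct.tmul_add]
    | tmul x g =>
      obtain ⟨_, ⟨𝓧⟩⟩ := exists_repr_fin x
      obtain ⟨_, ⟨𝓣⟩⟩ := exists_repr_fin t
      obtain ⟨_, g₁, g₂, hg⟩ := exists_sum_mul_eq H g
      have hx := sum_counit_smul 𝓧
      rw [hmul f g counit counit x t _ _ Unit _ _ _ Finset.univ Finset.univ _ _ _ _
        (fun _ => counit) (fun _ => counit) g₁ g₂ 𝓧.eq.symm 𝓣.eq.symm (by simp) hg]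
      have := sum_repr_eq 𝓣 (ℛ ℂ t) (Θ (f ⊗ₜ (x ⊗ₜ g)) ∘ₗ TensorProduct.mk ℂ H (H ⊗[ℂ] H) y ∘ₗ
        TensorProduct.map (LinearMap.mulRight ℂ b) (LinearMap.mulRight ℂ z))
      simp only [LinearMap.comp_apply, TensorProduct.map_tmul, LinearMap.mulRight_apply,
        TensorProduct.mk_apply] at this
      rw [← this]
      simp only [map_sum, map_smul, LinearMap.sum_apply, LinearMap.smul_apply, Θ,
        tripleDualEquiv_tmul, conv_counit, Finset.univ_unique, Finset.sum_singleton, hF, ← hg,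
        smul_eq_mul]
      rw [Finset.sum_comm]
      refine Finset.sum_congr rfl fun i _ => ?_
      conv_rhs => rw [← hx]
      simp only [Finset.sum_mul, Finset.mul_sum, smul_mul_assoc, map_sum, map_smul, smul_eq_mul,
        mul_assoc]
      rw [Finset.sum_comm]
      refine Finset.sum_congr rfl fun j _ => Finset.sum_congr rfl fun k _ => ?_
      ring
  have hleft : ∀ w (t y b z : H),
      Θ (mul ((counit (R := ℂ) : Module.Dual ℂ H) ⊗ₜ[ℂ]
        (t ⊗ₜ[ℂ] (counit (R := ℂ) : Module.Dual ℂ H))) w) (y ⊗ₜ (b ⊗ₜ z)) =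
      ∑ i ∈ (ℛ ℂ t).index, Θ w ((y * (ℛ ℂ t).left i) ⊗ₜ ((b * (ℛ ℂ t).right i) ⊗ₜ z)) := by
    intro w t y b z
    induction w using TensorProduct.induction_on with
    | zero => simp
    | add u v hu hv => simp [hu, hv, Finset.sum_add_distrib]
    | tmul f v =>
    induction v using TensorProduct.induction_on with
    | zero => simp
    | add u v hu hv => simp [hu, hv, Finset.sum_add_distrib, TensorProduct.tmul_add]
    | tmul x g =>
      obtain ⟨_, ⟨𝓧⟩⟩ := exists_repr_fin x
      obtain ⟨_, ⟨𝓣⟩⟩ := exists_repr_fin t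
      obtain ⟨_, f₁, f₂, hf⟩ := exists_sum_mul_eq H f
      have hx := sum_counit_right_smul 𝓧
      rw [hmul counit counit f g t x _ _ _ Unit _ _ Finset.univ Finset.univ _ _ _ _
        f₁ f₂ (fun _ => counit) (fun _ => counit) 𝓣.eq.symm 𝓧.eq.symm hf (by simp)]
      have := sum_repr_eq 𝓣 (ℛ ℂ t) (Θ (f ⊗ₜ (x ⊗ₜ g)) ∘ₗ
        TensorProduct.map (LinearMap.mulLeft ℂ y)
          ((TensorProduct.mk ℂ H H).flip z ∘ₗ LinearMap.mulLeft ℂ b))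
      simp only [LinearMap.comp_apply, TensorProduct.map_tmul, LinearMap.mulLeft_apply,
        TensorProduct.mk_apply, LinearMap.flip_apply] at this
      rw [← this]
      simp only [map_sum, map_smul, LinearMap.sum_apply, LinearMap.smul_apply, Θ,
        tripleDualEquiv_tmul, counit_conv, Finset.univ_unique, Finset.sum_singleton, hF, ← hf,
        smul_eq_mul]
      refine Finset.sum_congr rfl fun i _ => ?_
      rw [← mul_assoc x, htr _ (𝓣.right i)]
      conv_rhs => rw [← hx]
      simp only [Finset.sum_mul, Finset.mul_sum, smul_mul_assoc, mul_smul_comm, map_sum, map_smul,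
        smul_eq_mul, mul_assoc]
      refine Finset.sum_congr rfl fun j _ => Finset.sum_congr rfl fun k _ => ?_
      ring
  have hmem : ∀ w, (∀ t : H, mul w ((counit (R := ℂ) : Module.Dual ℂ H) ⊗ₜ[ℂ]
          (t ⊗ₜ[ℂ] (counit (R := ℂ) : Module.Dual ℂ H))) =
        mul ((counit (R := ℂ) : Module.Dual ℂ H) ⊗ₜ[ℂ]
          (t ⊗ₜ[ℂ] (counit (R := ℂ) : Module.Dual ℂ H))) w) ↔ w ∈ Set.range Ψ := by
    intro w
    trans IsMiddleEquivariant (Θ w)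
    · refine ⟨fun hw t y b z => by rw [← hright, ← hleft, hw t], fun hw t => Θ.injective <|
        TensorProduct.ext_threefold' fun y b z => by rw [hright, hleft, hw t y b z]⟩
    rw [isMiddleEquivariant_iff hS]
    constructor
    · rintro ⟨u, hu⟩
      obtain ⟨v, rfl⟩ := (TensorProduct.dualDistribEquiv ℂ H H).surjective u
      exact ⟨v, Θ.injective (by rw [hΘΨ, hu])⟩
    · rintro ⟨v, rfl⟩
      exact ⟨_, (hΘΨ v).symm⟩
  have hinj : Function.Injective Ψ := fun u v huv =>
    (TensorProduct.dualDistribEquiv ℂ H H).injective <| comp_twistedAdjointMul_injective hS <| by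
      simp only [← hΘΨ, huv]
  have hfinrank : Set.finrank ℂ (Set.range Ψ) = Module.finrank ℂ H ^ 2 := by
    rw [Set.finrank, ← LinearMap.coe_range, Submodule.span_eq, LinearMap.finrank_range_of_inj hinj,
      Module.finrank_tensorProduct, Subspace.dual_finrank_eq, sq]
  refine (?_ : ∀ S, S = Set.range Ψ → S = Set.range Ψ ∧ Function.Injective Ψ ∧
    Set.finrank ℂ S = Module.finrank ℂ H ^ 2) _ (Set.ext hmem)
  rintro _ rfl
  exact ⟨rfl, hinj, hfinrank⟩
end

section
/- Let H be a finite-dimensional Hopf algebra over ℂ with involutive antipode (S∘S = id) and let h ∈ H be a normalized two-sided integral. Then Δ(h) is symmetric, i.e., h₁ ⊗ h₂ = h₂ ⊗ h₁ in H ⊗ H, and consequently for every integer l ≥ 2 the iterated coproduct of h is invariant under cyclic permutation: h₁ ⊗ h₂ ⊗ ⋯ ⊗ h_l = h₂ ⊗ h₃ ⊗ ⋯ ⊗ h_l ⊗ h₁ in H^{⊗l}. -/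
open TensorProduct

variable (H : Type*) [Ring H] [HopfAlgebra ℂ H]

/-- The ordered convolution product `f₀ * f₁ * ⋯ * f_{l-1}` of a list of functionals; by
counitality, applied to `x` it computes `f₀(x₁)f₁(x₂)⋯f_{l-1}(x_l)`, the pairing of
`f₀ ⊗ ⋯ ⊗ f_{l-1}` with the iterated coproduct `x₁ ⊗ x₂ ⊗ ⋯ ⊗ x_l`. -/
noncomputable def convList (L : List (Module.Dual ℂ H)) : Module.Dual ℂ H :=
  L.foldr (conv H) (Coalgebra.counit (R := ℂ))

section

variable {H}

open Coalgebra HopfAlgebra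

/-- The operator `x ↦ f(x₁) x₂`, the transpose of left convolution by `f`. -/
noncomputable def hitRight (f : Module.Dual ℂ H) : Module.End ℂ H :=
  (TensorProduct.lid ℂ H).toLinearMap ∘ₗ f.rTensor H ∘ₗ comul

theorem hitRight_counit : hitRight (counit (R := ℂ) (A := H)) = 1 := by
  ext x
  simp [hitRight]

theorem hitRight_conv (f g : Module.Dual ℂ H) :
    hitRight (conv H f g) = hitRight g * hitRight f := by
  ext x
  let T : H ⊗[ℂ] (H ⊗[ℂ] H) →ₗ[ℂ] H :=
    (TensorProduct.lid ℂ H).toLinearMap ∘ₗ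
      TensorProduct.map f ((TensorProduct.lid ℂ H).toLinearMap ∘ₗ g.rTensor H)
  have key₁ : ∀ y : H ⊗[ℂ] H,
      TensorProduct.lid ℂ H ((conv H f g).rTensor H y) =
        T (TensorProduct.assoc ℂ H H H (comul.rTensor H y)) := by
    intro y
    induction y with
    | zero => simp
    | add a b ha hb => simp only [map_add, ha, hb]
    | tmul a b =>
      simp only [LinearMap.rTensor_tmul, conv, LinearMap.comp_apply]
      induction comul (R := ℂ) a with
      | zero => simp
      | add c d hc hd =>
        simp only [map_add, TensorProduct.add_tmul, TensorProduct.lid_tmul] at hc hd ⊢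
        rw [← hc, ← hd]
      | tmul c d => simp [T, mul_smul, smul_comm (f c)]
  have key₂ : ∀ y : H ⊗[ℂ] H,
      hitRight g (TensorProduct.lid ℂ H (f.rTensor H y)) = T (comul.lTensor H y) := by
    intro y
    induction y with
    | zero => simp
    | add a b ha hb => simp only [map_add, ha, hb]
    | tmul a b => simp [T, hitRight]
  have h₁ := key₁ (comul x)
  rw [coassoc_apply, ← key₂] at h₁
  exact h₁

theorem hitRight_convList_append_singleton (L : List (Module.Dual ℂ H)) (f : Module.Dual ℂ H) :
    hitRight (convList H (L ++ [f])) = hitRight f * hitRight (convList H L) := by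
  induction L with
  | nil => simp [convList, hitRight_conv, hitRight_counit]
  | cons g L ih =>
    have hcons : ∀ M, convList H (g :: M) = conv H g (convList H M) := fun _ => rfl
    rw [List.cons_append, hcons, hcons, hitRight_conv, hitRight_conv, ih, mul_assoc]

/-- The map `v ⊗ w ↦ S(w) v`. -/
noncomputable def antipodeMulSwap : H ⊗[ℂ] H →ₗ[ℂ] H :=
  LinearMap.mul' ℂ H ∘ₗ (antipode ℂ).rTensor H ∘ₗ (TensorProduct.comm ℂ H H).toLinearMap

theorem antipodeMulSwap_comul
    (hS : ∀ x : H, antipode (R := ℂ) (antipode (R := ℂ) x) = x) (x : H) :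
    antipodeMulSwap (comul (R := ℂ) x) = counit (R := ℂ) x • 1 := by
  have key : ∀ y : H ⊗[ℂ] H,
      antipodeMulSwap y = antipode ℂ (LinearMap.mul' ℂ H ((antipode ℂ).rTensor H y)) := by
    intro y
    induction y with
    | zero => simp
    | add a b ha hb => simp only [map_add, ha, hb]
    | tmul a b => simp [antipodeMulSwap, antipode_mul_antidistrib, hS]
  rw [key, mul_antipode_rTensor_comul_apply, Algebra.algebraMap_eq_smul_one, map_smul,
    antipode_one]

theorem hitRight_comp_mulLeft
    (hS : ∀ x : H, antipode (R := ℂ) (antipode (R := ℂ) x) = x)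
    (f : Module.Dual ℂ H) {ι : Type*} (a : H) (r : Coalgebra.Repr ℂ a ι) :
    hitRight (f ∘ₗ LinearMap.mulLeft ℂ a) = ∑ i ∈ r.index,
      LinearMap.mulLeft ℂ (antipode ℂ (r.right i)) * hitRight f *
        LinearMap.mulLeft ℂ (r.left i) := by
  ext x
  have key : ∀ y : H ⊗[ℂ] H, TensorProduct.lid ℂ H ((f ∘ₗ LinearMap.mulLeft ℂ a).rTensor H y) =
      ∑ i ∈ r.index, antipode ℂ (r.right i) *
        TensorProduct.lid ℂ H (f.rTensor H (comul (R := ℂ) (r.left i) * y)) := by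
    intro y
    induction y with
    | zero => simp
    | add y z hy hz => simp only [map_add, hy, hz, mul_add, Finset.sum_add_distrib]
    | tmul p q =>
      let T : H ⊗[ℂ] (H ⊗[ℂ] H) →ₗ[ℂ] H :=
        LinearMap.mulRight ℂ q ∘ₗ (TensorProduct.lid ℂ H).toLinearMap ∘ₗ
          TensorProduct.map (f ∘ₗ LinearMap.mulRight ℂ p) antipodeMulSwap
      have h₁ : ∀ z : H ⊗[ℂ] H, T (comul.lTensor H z) =
          f (TensorProduct.rid ℂ H (counit.lTensor H z) * p) • q := by
        intro z
        induction z with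
        | zero => simp
        | add a b ha hb => simp only [map_add, ha, hb, add_mul, add_smul]
        | tmul u v => simp [T, antipodeMulSwap_comul hS, smul_smul, mul_comm]
      have h₂ : ∀ (z : H ⊗[ℂ] H) (w : H), T (TensorProduct.assoc ℂ H H H (z ⊗ₜ w)) =
          antipode ℂ w * TensorProduct.lid ℂ H (f.rTensor H (z * p ⊗ₜ q)) := by
        intro z w
        induction z with
        | zero => simp
        | add a b ha hb => simp only [map_add, TensorProduct.add_tmul, ha, hb, add_mul, mul_add]
        | tmul u v => simp [T, antipodeMulSwap, mul_assoc]
      have h₃ := h₁ (comul a)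
      rw [← coassoc_apply, lTensor_counit_comul, ← r.eq] at h₃
      simp only [map_sum, LinearMap.rTensor_tmul, h₂] at h₃
      rw [h₃]
      simp
  have hx := key (comul x)
  simp only [← Bialgebra.comul_mul] at hx
  simpa [hitRight] using hx

theorem trace_hitRight_comp_mulLeft
    (hS : ∀ x : H, antipode (R := ℂ) (antipode (R := ℂ) x) = x)
    (f : Module.Dual ℂ H) (a : H) :
    LinearMap.trace ℂ H (hitRight (f ∘ₗ LinearMap.mulLeft ℂ a)) =
      counit (R := ℂ) a * LinearMap.trace ℂ H (hitRight f) := by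
  have hsum : ∑ i ∈ (Coalgebra.Repr.arbitrary ℂ a).index,
      LinearMap.mulLeft ℂ ((Coalgebra.Repr.arbitrary ℂ a).left i) *
        LinearMap.mulLeft ℂ (antipode ℂ ((Coalgebra.Repr.arbitrary ℂ a).right i)) =
      counit (R := ℂ) a • (1 : Module.End ℂ H) := by
    ext x
    simp only [LinearMap.sum_apply, Module.End.mul_apply, LinearMap.mulLeft_apply, ← mul_assoc,
      ← Finset.sum_mul, sum_mul_antipode_eq_smul]
    simp
  rw [hitRight_comp_mulLeft hS f a (Coalgebra.Repr.arbitrary ℂ a), map_sum]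
  simp_rw [mul_assoc, LinearMap.trace_mul_comm ℂ (LinearMap.mulLeft ℂ (antipode ℂ _)), mul_assoc]
  rw [← map_sum, ← Finset.mul_sum, hsum, mul_smul_comm, mul_one, map_smul, smul_eq_mul]

theorem trace_hitRight_eq_finrank_mul [FiniteDimensional ℂ H]
    (hS : ∀ x : H, antipode (R := ℂ) (antipode (R := ℂ) x) = x) (h : H)
    (hh_right : ∀ x : H, h * x = counit (R := ℂ) x • h)
    (hh_one : counit (R := ℂ) h = 1) (f : Module.Dual ℂ H) :
    LinearMap.trace ℂ H (hitRight f) = Module.finrank ℂ H * f h := by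
  let τ : Module.Dual ℂ (Module.Dual ℂ H) :=
    { toFun f := LinearMap.trace ℂ H (hitRight f)
      map_add' f g := by
        simp only [hitRight, LinearMap.rTensor_add, LinearMap.add_comp, LinearMap.comp_add, map_add]
      map_smul' c f := by
        simp only [hitRight, LinearMap.rTensor_smul, LinearMap.smul_comp, LinearMap.comp_smul,
          map_smul, RingHom.id_apply] }
  obtain ⟨t, ht⟩ := (Module.evalEquiv ℂ H).surjective τ
  have hτ : ∀ g : Module.Dual ℂ H, LinearMap.trace ℂ H (hitRight g) = g t := fun g =>
    (DFunLike.congr_fun ht g).symm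
  have hcounit : counit (R := ℂ) t = Module.finrank ℂ H := by
    rw [← hτ, hitRight_counit, LinearMap.trace_one]
  rw [← one_mul (LinearMap.trace ℂ H (hitRight f)), ← hh_one,
    ← trace_hitRight_comp_mulLeft hS, hτ, LinearMap.comp_apply, LinearMap.mulLeft_apply,
    hh_right, map_smul, hcounit, smul_eq_mul]

theorem eval_eq_of_trace_hitRight_eq [FiniteDimensional ℂ H]
    (hS : ∀ x : H, antipode (R := ℂ) (antipode (R := ℂ) x) = x) (h : H)
    (hh_right : ∀ x : H, h * x = counit (R := ℂ) x • h)
    (hh_one : counit (R := ℂ) h = 1) {f g : Module.Dual ℂ H}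
    (hfg : LinearMap.trace ℂ H (hitRight f) = LinearMap.trace ℂ H (hitRight g)) : f h = g h := by
  have : Nontrivial H := Bialgebra.nontrivial (R := ℂ)
  have hn : (Module.finrank ℂ H : ℂ) ≠ 0 := Nat.cast_ne_zero.mpr Module.finrank_pos.ne'
  rw [trace_hitRight_eq_finrank_mul hS h hh_right hh_one,
    trace_hitRight_eq_finrank_mul hS h hh_right hh_one] at hfg
  exact mul_left_cancel₀ hn hfg

end

/-- Let `H` be a finite-dimensional Hopf algebra over `ℂ` with involutive antipode and `h ∈ H`
a normalized two-sided integral.  Then `Δ(h)` is symmetric, `h₁ ⊗ h₂ = h₂ ⊗ h₁`, and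
consequently for every `l ≥ 2` the iterated coproduct `h₁ ⊗ ⋯ ⊗ h_l` is invariant under cyclic
permutation; the latter is expressed by pairing with arbitrary tuples of functionals: for every
`f : Fin l → H*`, `f₀(h₁)⋯f_{l-1}(h_l) = f₁(h₁)⋯f_{l-1}(h_{l-1})f₀(h_l)` (i.e. the ordered
convolution products of `f` and of its cyclic rotation agree at `h`; since `H` is
finite-dimensional, functionals of this form separate the points of `H^⊗l`). -/
theorem integral_comul_symm_and_cyclic
    [FiniteDimensional ℂ H]
    (hS : ∀ x : H, HopfAlgebra.antipode (R := ℂ) (HopfAlgebra.antipode (R := ℂ) x) = x)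
    (h : H)
    (hh_left : ∀ x : H, x * h = Coalgebra.counit (R := ℂ) x • h)
    (hh_right : ∀ x : H, h * x = Coalgebra.counit (R := ℂ) x • h)
    (hh_one : Coalgebra.counit (R := ℂ) h = 1) :
    TensorProduct.comm ℂ H H (Coalgebra.comul (R := ℂ) h) = Coalgebra.comul (R := ℂ) h ∧
    ∀ (l : ℕ), 2 ≤ l → ∀ f : Fin l → Module.Dual ℂ H,
      convList H (List.ofFn f) h = convList H ((List.ofFn f).rotate 1) h := by
  have hcomm : ∀ f g : Module.Dual ℂ H, conv H f g h = conv H g f h := fun f g =>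
    eval_eq_of_trace_hitRight_eq hS h hh_right hh_one <| by
      rw [hitRight_conv, hitRight_conv, LinearMap.trace_mul_comm]
  refine ⟨?_, fun l hl f => ?_⟩
  · refine sub_eq_zero.mp ((Module.forall_dual_apply_eq_zero_iff ℂ _).mp fun φ => ?_)
    obtain ⟨t, rfl⟩ := (TensorProduct.dualDistribEquiv ℂ H H).surjective φ
    induction t with
    | zero => simp
    | add a b ha hb => rw [map_add, LinearMap.add_apply, ha, hb, add_zero]
    | tmul f g =>
      have hswap : ∀ y : H ⊗[ℂ] H, TensorProduct.dualDistrib ℂ H H (f ⊗ₜ g)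
          (TensorProduct.comm ℂ H H y) = TensorProduct.dualDistrib ℂ H H (g ⊗ₜ f) y := by
        intro y
        induction y with
        | zero => simp
        | add a b ha hb => simp only [map_add, ha, hb]
        | tmul a b => simp [mul_comm]
      rw [map_sub, sub_eq_zero]
      exact (hswap _).trans (hcomm g f)
  · obtain ⟨n, rfl⟩ : ∃ n, l = n + 1 := ⟨l - 1, by omega⟩
    rw [List.ofFn_succ, List.rotate_cons_succ, List.rotate_zero]
    apply eval_eq_of_trace_hitRight_eq hS h hh_right hh_one
    rw [hitRight_convList_append_singleton, LinearMap.trace_mul_comm]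
    exact congrArg _ (hitRight_conv _ _)
end
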